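/- Let U = SC be the evolution operator of Szegedy's walk on P_{n+1} associated to a birth and death chain with reflecting walls with stationary distribution π. Define v_0(j) = √π(j) and v_n(j) = (−1)^j √π(j), and for v ∈ ℝ^{n+1} let |v̄⟩ = v(0)|0⟩⊗|R⟩ + Σ_{j=1}^{n−1} v(j)|j⟩⊗|φ_j⟩ + v(n)|n⟩⊗|L⟩. Then U|v̄_0⟩ = |v̄_0⟩ and U|v̄_n⟩ = −|v̄_n⟩; that is, 1 and −1 are eigenvalues of U with eigenvectors |v̄_0⟩ and |v̄_n⟩ built from the eigenvectors of the Jacobi matrix with eigenvalues 1 and −1. -/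

import Mathlib

open Finset Matrix

/-- The unnormalized weight `(p^R_0 ⋯ p^R_{j-1}) / (p^L_1 ⋯ p^L_j)`. -/
noncomputable def bdRatio (pL pR : ℕ → ℝ) (j : ℕ) : ℝ :=
  (∏ i ∈ Finset.range j, pR i) / (∏ i ∈ Finset.range j, pL (i + 1))

/-- The normalizing constant `C_π = 1 + ∑_{j=1}^{n} (p^R_0 ⋯ p^R_{j-1})/(p^L_1 ⋯ p^L_j)`. -/
noncomputable def bdCpi (n : ℕ) (pL pR : ℕ → ℝ) : ℝ :=
  1 + ∑ j ∈ Finset.Icc 1 n, bdRatio pL pR j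

/-- The stationary distribution `π(j)` of the birth and death chain. -/
noncomputable def bdPi (n : ℕ) (pL pR : ℕ → ℝ) (j : ℕ) : ℝ :=
  bdRatio pL pR j / bdCpi n pL pR

/-- The local coin state `|φ_j⟩ = √(p^L_j)|L⟩ + √(p^R_j)|R⟩`, with `|L⟩` the coin state
`0` and `|R⟩` the coin state `1`. -/
noncomputable def phiCoin (pL pR : ℕ → ℝ) (j : ℕ) : Fin 2 → ℝ := fun b =>
  if b = 0 then Real.sqrt (pL j) else Real.sqrt (pR j)

/-- The coin operator `C = |0⟩⟨0|⊗I₂ + ∑_{j=1}^{n−1}|j⟩⟨j|⊗(2|φ_j⟩⟨φ_j| − I₂) + |n⟩⟨n|⊗I₂`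
of Szegedy's walk on `P_{n+1}`. -/
noncomputable def szegedyCoin (n : ℕ) (pL pR : ℕ → ℝ) :
    Matrix (Fin (n + 1) × Fin 2) (Fin (n + 1) × Fin 2) ℂ := fun q r =>
  if q.1 = r.1 then
    (if (q.1 : ℕ) = 0 ∨ (q.1 : ℕ) = n then (if q.2 = r.2 then 1 else 0)
     else (((2 * phiCoin pL pR (q.1 : ℕ) q.2 * phiCoin pL pR (r.1 : ℕ) r.2 -
         if q.2 = r.2 then 1 else 0 : ℝ)) : ℂ))
  else 0

/-- The flip-flop shift operator `S` of Szegedy's walk, determined by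
`S(|j⟩⊗|L⟩) = |j−1⟩⊗|R⟩` and `S(|j⟩⊗|R⟩) = |j+1⟩⊗|L⟩`. -/
noncomputable def szegedyShift (n : ℕ) :
    Matrix (Fin (n + 1) × Fin 2) (Fin (n + 1) × Fin 2) ℂ := fun q r =>
  if r.2 = 0 ∧ q.2 = 1 ∧ (q.1 : ℕ) + 1 = (r.1 : ℕ) then 1
  else if r.2 = 1 ∧ q.2 = 0 ∧ (r.1 : ℕ) + 1 = (q.1 : ℕ) then 1
  else 0

/-- The lift `|v̄⟩ = v(0)|0⟩⊗|R⟩ + ∑_{j=1}^{n−1} v(j)|j⟩⊗|φ_j⟩ + v(n)|n⟩⊗|L⟩` of a vector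
`v ∈ ℝ^{n+1}`. -/
noncomputable def liftVec (n : ℕ) (pL pR : ℕ → ℝ) (v : Fin (n + 1) → ℝ) :
    Fin (n + 1) × Fin 2 → ℂ := fun q =>
  if (q.1 : ℕ) = 0 then (if q.2 = 1 then (v q.1 : ℂ) else 0)
  else if (q.1 : ℕ) = n then (if q.2 = 0 then (v q.1 : ℂ) else 0)
  else ((v q.1 * phiCoin pL pR (q.1 : ℕ) q.2 : ℝ) : ℂ)

theorem bdRatio_succ_mul (pL pR : ℕ → ℝ) (j : ℕ) (h : pL (j + 1) ≠ 0) :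
    bdRatio pL pR (j + 1) * pL (j + 1) = bdRatio pL pR j * pR j := by
  unfold bdRatio
  rw [Finset.prod_range_succ, Finset.prod_range_succ, div_mul_eq_mul_div,
    mul_div_mul_right _ _ h, mul_div_right_comm]

theorem bdCpi_pos (n : ℕ) (pL pR : ℕ → ℝ) (hL : ∀ j, j ≤ n → 0 ≤ pL j)
    (hR : ∀ j, j ≤ n → 0 ≤ pR j) : 0 < bdCpi n pL pR := by
  refine add_pos_of_pos_of_nonneg one_pos (Finset.sum_nonneg fun j hj => ?_)
  have hj := (Finset.mem_Icc.mp hj).2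
  exact div_nonneg
    (Finset.prod_nonneg fun i hi => hR i (by have := Finset.mem_range.mp hi; omega))
    (Finset.prod_nonneg fun i hi => hL (i + 1) (by have := Finset.mem_range.mp hi; omega))

theorem sqrt_bdPi_succ_mul (n : ℕ) (pL pR : ℕ → ℝ) (j : ℕ) (hL : 0 < pL (j + 1))
    (hR : 0 ≤ pR j) :
    √(bdPi n pL pR (j + 1)) * √(pL (j + 1)) = √(bdPi n pL pR j) * √(pR j) := by
  rw [← Real.sqrt_mul' _ hL.le, ← Real.sqrt_mul' _ hR]
  unfold bdPi
  rw [div_mul_eq_mul_div, bdRatio_succ_mul pL pR j hL.ne', div_mul_eq_mul_div]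

theorem liftVec_apply (n : ℕ) (hn : n ≠ 0) (pL pR : ℕ → ℝ) (v : Fin (n + 1) → ℝ)
    (hL0 : pL 0 = 0) (hR0 : pR 0 = 1) (hLn : pL n = 1) (hRn : pR n = 0)
    (q : Fin (n + 1) × Fin 2) :
    liftVec n pL pR v q = ((v q.1 * phiCoin pL pR q.1 q.2 : ℝ) : ℂ) := by
  obtain ⟨j, b⟩ := q
  unfold liftVec phiCoin
  by_cases h0 : (j : ℕ) = 0
  · fin_cases b <;> simp [h0, hL0, hR0]
  · by_cases h1 : (j : ℕ) = n
    · fin_cases b <;> simp [h1, hn, hLn, hRn]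
    · simp [h0, h1]

theorem szegedyCoin_mulVec_liftVec (n : ℕ) (pL pR : ℕ → ℝ) (v : Fin (n + 1) → ℝ)
    (hL : ∀ j, j ≤ n → 0 ≤ pL j) (hR : ∀ j, j ≤ n → 0 ≤ pR j)
    (hsum : ∀ j, j ≤ n → pL j + pR j = 1) :
    (szegedyCoin n pL pR).mulVec (liftVec n pL pR v) = liftVec n pL pR v := by
  ext ⟨j, b⟩
  have hj : (j : ℕ) ≤ n := Nat.lt_succ_iff.mp j.2
  simp only [Matrix.mulVec, dotProduct, Fintype.sum_prod_type]
  rw [Finset.sum_eq_single j (fun k _ hk => by simp [szegedyCoin, Ne.symm hk]) (by simp),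
    Fin.sum_univ_two]
  by_cases h : (j : ℕ) = 0 ∨ (j : ℕ) = n
  · simp only [szegedyCoin, if_pos h, if_true]
    fin_cases b <;> simp
  · have h' := not_or.mp h
    have hunit : √(pL j) * √(pL j) + √(pR j) * √(pR j) = 1 := by
      rw [Real.mul_self_sqrt (hL j hj), Real.mul_self_sqrt (hR j hj), hsum j hj]
    simp only [szegedyCoin, liftVec, if_neg h, if_neg h'.1, if_neg h'.2, if_true]
    rw [← Complex.ofReal_mul, ← Complex.ofReal_mul, ← Complex.ofReal_add, Complex.ofReal_inj]
    fin_cases b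
    · simp [phiCoin]
      linear_combination 2 * v j * √(pL j) * hunit
    · simp [phiCoin]
      linear_combination 2 * v j * √(pR j) * hunit

theorem szegedyShift_mulVec_liftVec (n : ℕ) (hn : n ≠ 0) (pL pR : ℕ → ℝ)
    (v : Fin (n + 1) → ℝ) (ε : ℝ) (hε : ε * ε = 1)
    (hL0 : pL 0 = 0) (hR0 : pR 0 = 1) (hLn : pL n = 1) (hRn : pR n = 0)
    (hv : ∀ j : Fin n, v j.succ * √(pL (j + 1)) = ε * (v j.castSucc * √(pR j))) :
    (szegedyShift n).mulVec (liftVec n pL pR v) = (ε : ℂ) • liftVec n pL pR v := by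
  have hlift := liftVec_apply n hn pL pR v hL0 hR0 hLn hRn
  ext ⟨j, b⟩
  simp only [Matrix.mulVec, dotProduct, Pi.smul_apply, smul_eq_mul, hlift]
  fin_cases b
  · induction j using Fin.cases with
    | zero => simp [szegedyShift, phiCoin, hL0]
    | succ k =>
      rw [Finset.sum_eq_single (k.castSucc, 1)]
      · simp [szegedyShift, phiCoin]
        norm_cast
        rw [hv k]
        linear_combination -(v k.castSucc * √(pR k)) * hε
      · rintro ⟨i, c⟩ - hne
        have hentry : szegedyShift n (k.succ, 0) (i, c) = 0 := by
          simp only [szegedyShift, ne_eq, Prod.mk.injEq, Fin.ext_iff, Fin.val_castSucc,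
            Fin.val_succ] at hne ⊢
          grind
        exact mul_eq_zero_of_left hentry _
      · simp
  · induction j using Fin.lastCases with
    | last =>
      simp only [phiCoin, Fin.val_last, Fin.mk_one, Fin.isValue, one_ne_zero, if_false, hRn,
        Real.sqrt_zero, mul_zero, Complex.ofReal_zero]
      refine Finset.sum_eq_zero fun ⟨i, c⟩ _ => mul_eq_zero_of_left ?_ _
      have := i.2
      simp only [szegedyShift, Fin.val_last]
      grind
    | cast k =>
      rw [Finset.sum_eq_single (k.succ, 0)]
      · simp [szegedyShift, phiCoin]
        norm_cast
        exact hv k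
      · rintro ⟨i, c⟩ - hne
        have hentry : szegedyShift n (k.castSucc, 1) (i, c) = 0 := by
          simp only [szegedyShift, ne_eq, Prod.mk.injEq, Fin.ext_iff, Fin.val_castSucc,
            Fin.val_succ] at hne ⊢
          grind
        exact mul_eq_zero_of_left hentry _
      · simp

theorem liftVec_ne_zero (n : ℕ) (pL pR : ℕ → ℝ) (v : Fin (n + 1) → ℝ) (hv : v 0 ≠ 0) :
    liftVec n pL pR v ≠ 0 := fun h =>
  hv (by simpa [liftVec] using congrFun h (0, 1))

/-- For the evolution operator `U = SC` of Szegedy's walk: with `v_0(j) = √π(j)` and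
`v_n(j) = (−1)^j √π(j)`, the lifted vectors satisfy `U|v̄_0⟩ = |v̄_0⟩` and
`U|v̄_n⟩ = −|v̄_n⟩`; that is, `1` and `−1` are eigenvalues of `U` with eigenvectors
`|v̄_0⟩` and `|v̄_n⟩`. -/
theorem szegedy_trivial_eigenvectors (n : ℕ) (hn : 2 ≤ n) (pL pR : ℕ → ℝ)
    (hsum : ∀ j, j ≤ n → pL j + pR j = 1)
    (hL : ∀ j, 1 ≤ j → j ≤ n - 1 → 0 < pL j ∧ pL j < 1)
    (hR0 : pR 0 = 1) (hLn : pL n = 1) :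
    ((szegedyShift n * szegedyCoin n pL pR).mulVec
        (liftVec n pL pR fun j : Fin (n + 1) => Real.sqrt (bdPi n pL pR j)) =
        liftVec n pL pR (fun j : Fin (n + 1) => Real.sqrt (bdPi n pL pR j)) ∧
      liftVec n pL pR (fun j : Fin (n + 1) => Real.sqrt (bdPi n pL pR j)) ≠ 0) ∧
    ((szegedyShift n * szegedyCoin n pL pR).mulVec
        (liftVec n pL pR fun j : Fin (n + 1) =>
          (-1 : ℝ) ^ (j : ℕ) * Real.sqrt (bdPi n pL pR j)) =
        -liftVec n pL pR (fun j : Fin (n + 1) =>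
          (-1 : ℝ) ^ (j : ℕ) * Real.sqrt (bdPi n pL pR j)) ∧
      liftVec n pL pR (fun j : Fin (n + 1) =>
        (-1 : ℝ) ^ (j : ℕ) * Real.sqrt (bdPi n pL pR j)) ≠ 0) := by
  have hn0 : n ≠ 0 := by omega
  have hL0 : pL 0 = 0 := by linarith [hsum 0 n.zero_le]
  have hRn : pR n = 0 := by linarith [hsum n le_rfl]
  have hLpos : ∀ j, 1 ≤ j → j ≤ n → 0 < pL j := fun j h1 h2 => by
    rcases h2.eq_or_lt with rfl | h
    · simp [hLn]
    · exact (hL j h1 (by omega)).1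
  have hLnonneg : ∀ j, j ≤ n → 0 ≤ pL j := fun j h => by
    rcases Nat.eq_zero_or_pos j with rfl | h1
    · exact hL0.ge
    · exact (hLpos j h1 h).le
  have hRnonneg : ∀ j, j ≤ n → 0 ≤ pR j := fun j h => by
    rcases Nat.eq_zero_or_pos j with rfl | h1
    · simp [hR0]
    · rcases h.eq_or_lt with rfl | h2
      · exact hRn.ge
      · linarith [(hL j h1 (by omega)).2, hsum j h]
  have hpi0 : √(bdPi n pL pR 0) ≠ 0 := by
    refine (Real.sqrt_pos.mpr (div_pos ?_ (bdCpi_pos n pL pR hLnonneg hRnonneg))).ne'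
    simp [bdRatio]
  have hbal : ∀ j : Fin n, √(bdPi n pL pR (j + 1)) * √(pL (j + 1)) =
      √(bdPi n pL pR j) * √(pR j) := fun j =>
    sqrt_bdPi_succ_mul n pL pR j (hLpos _ (by omega) j.2) (hRnonneg _ j.2.le)
  refine ⟨⟨?_, liftVec_ne_zero n pL pR _ hpi0⟩, ?_, liftVec_ne_zero n pL pR _ (by simpa using hpi0)⟩
  · rw [← Matrix.mulVec_mulVec, szegedyCoin_mulVec_liftVec n pL pR _ hLnonneg hRnonneg hsum,
      szegedyShift_mulVec_liftVec n hn0 pL pR _ 1 (by norm_num) hL0 hR0 hLn hRn]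
    · simp
    · intro j
      simpa using hbal j
  · rw [← Matrix.mulVec_mulVec, szegedyCoin_mulVec_liftVec n pL pR _ hLnonneg hRnonneg hsum,
      szegedyShift_mulVec_liftVec n hn0 pL pR _ (-1) (by norm_num) hL0 hR0 hLn hRn]
    · simp
    · intro j
      simp only [Fin.val_succ, Fin.val_castSucc, pow_succ]
      linear_combination -(-1 : ℝ) ^ (j : ℕ) * hbal j
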